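/- In the backward framework, the flux vanishes in the limit and the solution tends to 0 along the forward light cone: lim_{T→0+} F(0,T) = 0 and lim_{T→0+} u(T,T) = 0. -/

import Mathlib

open Real MeasureTheory Set Filter Topology

/-- Time derivative `u_t`. -/
noncomputable def ut (u : ℝ → ℝ → ℝ) (t r : ℝ) : ℝ := deriv (fun s => u s r) t

/-- Radial derivative `u_r`. -/
noncomputable def ur (u : ℝ → ℝ → ℝ) (t r : ℝ) : ℝ := deriv (fun s => u t s) r

/-- Second time derivative `u_tt`. -/
noncomputable def utt (u : ℝ → ℝ → ℝ) (t r : ℝ) : ℝ := deriv (fun s => ut u s r) t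

/-- Second radial derivative `u_rr`. -/
noncomputable def urr (u : ℝ → ℝ → ℝ) (t r : ℝ) : ℝ := deriv (fun s => ur u t s) r

/-- Null derivative `u₊ = u_t + u_r`. -/
noncomputable def uplus (u : ℝ → ℝ → ℝ) (t r : ℝ) : ℝ := ut u t r + ur u t r

/-- Null derivative `u₋ = u_t - u_r`. -/
noncomputable def uminus (u : ℝ → ℝ → ℝ) (t r : ℝ) : ℝ := ut u t r - ur u t r

/-- The Adkins–Nappi equivariant wave equation at the point `(t, r)`. -/
def ANeq (u : ℝ → ℝ → ℝ) (t r : ℝ) : Prop :=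
  utt u t r - urr u t r - (2 / r) * ur u t r + Real.sin (2 * u t r) / r ^ 2 +
      (u t r - Real.sin (u t r) * Real.cos (u t r)) * (1 - Real.cos (2 * u t r)) / r ^ 4 = 0

/-- The energy density `e(t,r)`. -/
noncomputable def eDens (u : ℝ → ℝ → ℝ) (t r : ℝ) : ℝ :=
  (1 / 2) * (ut u t r ^ 2 + ur u t r ^ 2) + Real.sin (u t r) ^ 2 / r ^ 2 +
    (u t r - Real.sin (u t r) * Real.cos (u t r)) ^ 2 / (2 * r ^ 4)

/-- The backward domain `D(T̄)`. -/
def Dom (T : ℝ) : Set (ℝ × ℝ) :=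
  {p : ℝ × ℝ | 0 < p.1 ∧ p.1 ≤ 2 * T ∧ 0 ≤ p.2 ∧ p.2 ≤ min (2 * T - p.1) p.1}

/-- The local energy `E(t) = ∫_0^t e(t,r) r² dr`. -/
noncomputable def locE (u : ℝ → ℝ → ℝ) (t : ℝ) : ℝ := ∫ r in (0 : ℝ)..t, eDens u t r * r ^ 2

/-- The flux `F(t₀, t₁)` through the light cone `t = r`. -/
noncomputable def flux (u : ℝ → ℝ → ℝ) (t₀ t₁ : ℝ) : ℝ :=
  ∫ r in t₀..t₁,
    ((1 / 2) * uplus u r r ^ 2 + Real.sin (u r r) ^ 2 / r ^ 2 +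
      (u r r - Real.sin (u r r) * Real.cos (u r r)) ^ 2 / (2 * r ^ 4)) * r ^ 2

/-- The backward framework: `u` is smooth on a neighborhood of `D(T̄)`, solves the
Adkins–Nappi equation on `D(T̄)` (for `r > 0`), and has finite energy `E(T̄)`. -/
def BackwardFramework (u : ℝ → ℝ → ℝ) (T : ℝ) : Prop :=
  0 < T ∧
  (∃ V : Set (ℝ × ℝ), IsOpen V ∧ Dom T ⊆ V ∧
    ContDiffOn ℝ (⊤ : ℕ∞) (fun p : ℝ × ℝ => u p.1 p.2) V) ∧
  (∀ p ∈ Dom T, 0 < p.2 → ANeq u p.1 p.2) ∧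
  IntegrableOn (fun r => eDens u T r * r ^ 2) (Set.Ioc 0 T)


/-- The nonlinearity `x - sin x cos x`. -/
noncomputable def anP (x : ℝ) : ℝ := x - Real.sin x * Real.cos x

/-- A primitive of `anP`. -/
noncomputable def anG (x : ℝ) : ℝ := (x ^ 2 - Real.sin x ^ 2) / 2

lemma hasDerivAt_anP (x : ℝ) : HasDerivAt anP (1 - Real.cos (2 * x)) x := by
  have h := (hasDerivAt_id x).sub ((Real.hasDerivAt_sin x).mul (Real.hasDerivAt_cos x))
  refine h.congr_deriv ?_
  rw [Real.cos_two_mul]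
  nlinarith [Real.sin_sq_add_cos_sq x]

lemma hasDerivAt_anG (x : ℝ) : HasDerivAt anG (anP x) x := by
  have h := (((hasDerivAt_id x).pow 2).sub ((Real.hasDerivAt_sin x).pow 2)).div_const 2
  refine h.congr_deriv ?_
  simp [anP]
  ring

lemma anP_zero : anP 0 = 0 := by simp [anP]

lemma anP_monotone : Monotone anP :=
  monotone_of_deriv_nonneg (fun x => (hasDerivAt_anP x).differentiableAt) fun x => by
    rw [(hasDerivAt_anP x).deriv]
    linarith [Real.cos_le_one (2 * x)]

lemma anP_neg (x : ℝ) : anP (-x) = -anP x := by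
  simp [anP]; ring

lemma anP_pos {c : ℝ} (hc : 0 < c) : 0 < anP c := by
  have h := Real.sin_lt (x := 2 * c) (by linarith)
  rw [Real.sin_two_mul] at h
  unfold anP
  linarith

lemma anP_nonneg {c : ℝ} (hc : 0 ≤ c) : 0 ≤ anP c := anP_zero ▸ anP_monotone hc

lemma anP_abs_sq (x : ℝ) : anP |x| ^ 2 = anP x ^ 2 := by
  rcases abs_choice x with h | h <;> rw [h]
  rw [anP_neg, neg_sq]

lemma anP_sq_le {c x : ℝ} (hc : 0 ≤ c) (hx : c ≤ |x|) : anP c ^ 2 ≤ anP x ^ 2 := by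
  rw [← anP_abs_sq x]
  exact pow_le_pow_left₀ (anP_nonneg hc) (anP_monotone hx) 2

lemma anP_sq_le_sq (x : ℝ) : anP x ^ 2 ≤ 4 * x ^ 2 := by
  have hle : anP |x| ≤ 2 * |x| := by
    have h := (abs_le.mp ((Real.abs_sin_le_abs (x := 2 * |x|)).trans_eq
      (abs_of_nonneg (by positivity)))).1
    rw [Real.sin_two_mul] at h
    unfold anP
    linarith
  have := pow_le_pow_left₀ (anP_nonneg (abs_nonneg x)) hle 2
  rw [anP_abs_sq, mul_pow, sq_abs] at this
  linarith

lemma anG_abs (x : ℝ) : anG |x| = anG x := by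
  rcases abs_choice x with h | h <;> rw [h]
  simp [anG]

lemma anG_monotoneOn : MonotoneOn anG (Ici 0) := by
  refine monotoneOn_of_deriv_nonneg (convex_Ici 0)
    (fun x _ => (hasDerivAt_anG x).continuousAt.continuousWithinAt)
    (fun x _ => (hasDerivAt_anG x).differentiableAt.differentiableWithinAt) fun x hx => ?_
  rw [(hasDerivAt_anG x).deriv]
  rw [interior_Ici] at hx
  exact anP_nonneg (le_of_lt hx)

lemma anG_le {c x : ℝ} (hc : 0 ≤ c) (hx : c ≤ |x|) : anG c ≤ anG x := by
  rw [← anG_abs x]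
  exact anG_monotoneOn hc (abs_nonneg x) hx

lemma anG_pos {c : ℝ} (hc : 0 < c) : 0 < anG c := by
  have h1 := Real.sin_sq_lt_sq hc.ne'
  unfold anG
  linarith

lemma anG_le_sq (x : ℝ) : anG x ≤ x ^ 2 / 2 := by
  unfold anG
  linarith [sq_nonneg (Real.sin x)]

section Partial

variable {f : ℝ → ℝ → ℝ} {V : Set (ℝ × ℝ)}

lemma hasDerivAt_fst {t r : ℝ} (hf : DifferentiableAt ℝ (fun p : ℝ × ℝ => f p.1 p.2) (t, r)) :
    HasDerivAt (fun s => f s r) (fderiv ℝ (fun p : ℝ × ℝ => f p.1 p.2) (t, r) (1, 0)) t :=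
  HasFDerivAt.comp_hasDerivAt (f := fun s => (s, r)) t hf.hasFDerivAt
    ((hasDerivAt_id t).prodMk (hasDerivAt_const t r))

lemma hasDerivAt_snd {t r : ℝ} (hf : DifferentiableAt ℝ (fun p : ℝ × ℝ => f p.1 p.2) (t, r)) :
    HasDerivAt (fun s => f t s) (fderiv ℝ (fun p : ℝ × ℝ => f p.1 p.2) (t, r) (0, 1)) r :=
  HasFDerivAt.comp_hasDerivAt (f := fun s => (t, s)) r hf.hasFDerivAt
    ((hasDerivAt_const r t).prodMk (hasDerivAt_id r))

lemma ut_eq_fderiv {t r : ℝ} (hf : DifferentiableAt ℝ (fun p : ℝ × ℝ => f p.1 p.2) (t, r)) :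
    ut f t r = fderiv ℝ (fun p : ℝ × ℝ => f p.1 p.2) (t, r) (1, 0) :=
  (hasDerivAt_fst hf).deriv

lemma ur_eq_fderiv {t r : ℝ} (hf : DifferentiableAt ℝ (fun p : ℝ × ℝ => f p.1 p.2) (t, r)) :
    ur f t r = fderiv ℝ (fun p : ℝ × ℝ => f p.1 p.2) (t, r) (0, 1) :=
  (hasDerivAt_snd hf).deriv

lemma differentiableAt_of_smooth (hV : IsOpen V)
    (hf : ContDiffOn ℝ (⊤ : ℕ∞) (fun p : ℝ × ℝ => f p.1 p.2) V) {p : ℝ × ℝ} (hp : p ∈ V) :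
    DifferentiableAt ℝ (fun p : ℝ × ℝ => f p.1 p.2) p :=
  (hf.contDiffAt (hV.mem_nhds hp)).differentiableAt (by simp)

lemma contDiffOn_ut (hV : IsOpen V)
    (hf : ContDiffOn ℝ (⊤ : ℕ∞) (fun p : ℝ × ℝ => f p.1 p.2) V) :
    ContDiffOn ℝ (⊤ : ℕ∞) (fun p : ℝ × ℝ => ut f p.1 p.2) V :=
  ((hf.fderiv_of_isOpen hV le_rfl).clm_apply contDiffOn_const).congr
    fun _ hp => ut_eq_fderiv (differentiableAt_of_smooth hV hf hp)

lemma contDiffOn_ur (hV : IsOpen V)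
    (hf : ContDiffOn ℝ (⊤ : ℕ∞) (fun p : ℝ × ℝ => f p.1 p.2) V) :
    ContDiffOn ℝ (⊤ : ℕ∞) (fun p : ℝ × ℝ => ur f p.1 p.2) V :=
  ((hf.fderiv_of_isOpen hV le_rfl).clm_apply contDiffOn_const).congr
    fun _ hp => ur_eq_fderiv (differentiableAt_of_smooth hV hf hp)

lemma ut_ur_comm (hV : IsOpen V)
    (hf : ContDiffOn ℝ (⊤ : ℕ∞) (fun p : ℝ × ℝ => f p.1 p.2) V) {t r : ℝ} (hp : (t, r) ∈ V) :
    ut (ur f) t r = ur (ut f) t r := by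
  have hsymm : IsSymmSndFDerivAt ℝ (fun p : ℝ × ℝ => f p.1 p.2) (t, r) :=
    (hf.contDiffAt (hV.mem_nhds hp)).isSymmSndFDerivAt (by
      rw [minSmoothness_of_isRCLikeNormedField]
      exact WithTop.coe_le_coe.2 (le_top : (2 : ℕ∞) ≤ ⊤))
  have hd : DifferentiableAt ℝ (fderiv ℝ (fun p : ℝ × ℝ => f p.1 p.2)) (t, r) :=
    ((hf.fderiv_of_isOpen (m := (⊤ : ℕ∞)) hV le_rfl).contDiffAt (hV.mem_nhds hp)).differentiableAt
      (by simp)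
  have key : ∀ v w : ℝ × ℝ,
      fderiv ℝ (fun p => fderiv ℝ (fun p : ℝ × ℝ => f p.1 p.2) p v) (t, r) w =
        fderiv ℝ (fderiv ℝ (fun p : ℝ × ℝ => f p.1 p.2)) (t, r) w v := fun v w => by
    rw [fderiv_clm_apply hd (differentiableAt_const v)]
    simp
  have er : (fun p : ℝ × ℝ => ur f p.1 p.2) =ᶠ[𝓝 (t, r)]
      fun p => fderiv ℝ (fun p : ℝ × ℝ => f p.1 p.2) p (0, 1) := by
    filter_upwards [hV.mem_nhds hp] with p hp
    exact ur_eq_fderiv (differentiableAt_of_smooth hV hf hp)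
  have et : (fun p : ℝ × ℝ => ut f p.1 p.2) =ᶠ[𝓝 (t, r)]
      fun p => fderiv ℝ (fun p : ℝ × ℝ => f p.1 p.2) p (1, 0) := by
    filter_upwards [hV.mem_nhds hp] with p hp
    exact ut_eq_fderiv (differentiableAt_of_smooth hV hf hp)
  rw [ut_eq_fderiv (differentiableAt_of_smooth hV (contDiffOn_ur hV hf) hp),
    ur_eq_fderiv (differentiableAt_of_smooth hV (contDiffOn_ut hV hf) hp),
    er.fderiv_eq, et.fderiv_eq, key, key]
  exact hsymm.eq _ _

end Partial

/-- If `∂ₜ q = ∂ᵣ m` in the cone `0 < r ≤ t`, the divergence theorem on the truncated cone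
`ε t ≤ r ≤ t`, `s ≤ t ≤ T`, in the coordinates `(t, r / t)`. -/
lemma integral_conservation_law {q m : ℝ → ℝ → ℝ} {s T ε : ℝ} (hs : 0 < s) (hsT : s ≤ T)
    (hε : 0 < ε) (hε1 : ε ≤ 1)
    (hq : ∀ t ∈ Icc s T, ∀ r ∈ Ioc 0 t, DifferentiableAt ℝ (fun p : ℝ × ℝ => q p.1 p.2) (t, r))
    (hm : ∀ t ∈ Icc s T, ∀ r ∈ Ioc 0 t, DifferentiableAt ℝ (fun p : ℝ × ℝ => m p.1 p.2) (t, r))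
    (hqm : ∀ t ∈ Icc s T, ∀ r ∈ Ioc 0 t, ut q t r = ur m t r) :
    ∫ t in s..T, (q t t + m t t) =
      (∫ r in (T * ε)..T, q T r) - (∫ r in (s * ε)..s, q s r) +
        ∫ t in s..T, (ε * q t (t * ε) + m t (t * ε)) := by
  set φ : ℝ × ℝ → ℝ × ℝ := fun p => (p.1, p.1 * p.2) with hφ
  set R : Set (ℝ × ℝ) := Icc s T ×ˢ Icc ε 1 with hR
  set f : ℝ × ℝ → ℝ := fun p => p.1 * q p.1 (p.1 * p.2) with hfdef
  set g : ℝ × ℝ → ℝ := fun p => -(p.2 * q p.1 (p.1 * p.2) + m p.1 (p.1 * p.2)) with hgdef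
  have hmem : ∀ p ∈ R, p.1 ∈ Icc s T ∧ p.1 * p.2 ∈ Ioc 0 p.1 := by
    rintro ⟨t, x⟩ ⟨ht, hx⟩
    simp only [mem_Icc] at ht hx
    have ht0 : 0 < t := by linarith
    exact ⟨ht, mul_pos ht0 (by linarith), by nlinarith⟩
  have hφd : ∀ p, HasFDerivAt φ ((ContinuousLinearMap.fst ℝ ℝ ℝ).prod
      (p.1 • ContinuousLinearMap.snd ℝ ℝ ℝ + p.2 • ContinuousLinearMap.fst ℝ ℝ ℝ)) p := fun p =>
    hasFDerivAt_fst.prodMk (hasFDerivAt_fst.mul hasFDerivAt_snd)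
  have hqφ : ∀ p ∈ R, HasFDerivAt (fun p : ℝ × ℝ => q p.1 (p.1 * p.2))
      ((fderiv ℝ (fun p : ℝ × ℝ => q p.1 p.2) (φ p)).comp ((ContinuousLinearMap.fst ℝ ℝ ℝ).prod
      (p.1 • ContinuousLinearMap.snd ℝ ℝ ℝ + p.2 • ContinuousLinearMap.fst ℝ ℝ ℝ))) p :=
    fun p hp => HasFDerivAt.comp (g := fun p : ℝ × ℝ => q p.1 p.2) (f := φ) p
      (hq _ (hmem p hp).1 _ (hmem p hp).2).hasFDerivAt (hφd p)
  have hmφ : ∀ p ∈ R, HasFDerivAt (fun p : ℝ × ℝ => m p.1 (p.1 * p.2))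
      ((fderiv ℝ (fun p : ℝ × ℝ => m p.1 p.2) (φ p)).comp ((ContinuousLinearMap.fst ℝ ℝ ℝ).prod
      (p.1 • ContinuousLinearMap.snd ℝ ℝ ℝ + p.2 • ContinuousLinearMap.fst ℝ ℝ ℝ))) p :=
    fun p hp => HasFDerivAt.comp (g := fun p : ℝ × ℝ => m p.1 p.2) (f := φ) p
      (hm _ (hmem p hp).1 _ (hmem p hp).2).hasFDerivAt (hφd p)
  have hf := fun p hp => (hasFDerivAt_fst (𝕜 := ℝ) (p := p)).mul (hqφ p hp)
  have hg := fun p hp =>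
    (((hasFDerivAt_snd (𝕜 := ℝ) (p := p)).mul (hqφ p hp)).add (hmφ p hp)).neg
  have hfd : ∀ p ∈ R, HasFDerivAt f (fderiv ℝ f p) p :=
    fun p hp => (hf p hp).differentiableAt.hasFDerivAt
  have hgd : ∀ p ∈ R, HasFDerivAt g (fderiv ℝ g p) p :=
    fun p hp => (hg p hp).differentiableAt.hasFDerivAt
  have hdiv : ∀ p ∈ R, fderiv ℝ f p (1, 0) + fderiv ℝ g p (0, 1) = 0 := by
    intro p hp
    have h1 := hqm _ (hmem p hp).1 _ (hmem p hp).2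
    rw [ut_eq_fderiv (hq _ (hmem p hp).1 _ (hmem p hp).2),
      ur_eq_fderiv (hm _ (hmem p hp).1 _ (hmem p hp).2)] at h1
    have e1 : ((1 : ℝ), p.2) = (1, 0) + p.2 • ((0 : ℝ), (1 : ℝ)) := by simp
    have e2 : ((0 : ℝ), p.1) = p.1 • ((0 : ℝ), (1 : ℝ)) := by simp
    have e3 : fderiv ℝ f p = _ := (hf p hp).fderiv
    have e4 : fderiv ℝ g p = _ := (hg p hp).fderiv
    rw [e3, e4]
    simp only [_root_.add_apply, _root_.smul_apply,
      ContinuousLinearMap.comp_apply, ContinuousLinearMap.prod_apply,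
      _root_.neg_apply, ContinuousLinearMap.coe_fst', ContinuousLinearMap.coe_snd',
      smul_eq_mul, mul_one, mul_zero, add_zero, zero_add, e1, e2, map_add, map_smul, hφ, h1]
    ring
  have hu1 : uIcc s T = Icc s T := uIcc_of_le hsT
  have hu2 : uIcc ε 1 = Icc ε 1 := uIcc_of_le hε1
  have hint := integral2_divergence_prod_of_hasFDerivAt_off_countable f g (fderiv ℝ f)
    (fderiv ℝ g) s ε T 1 ∅ countable_empty
    (by rw [hu1, hu2]; exact fun p hp => (hfd p hp).continuousAt.continuousWithinAt)
    (by rw [hu1, hu2]; exact fun p hp => (hgd p hp).continuousAt.continuousWithinAt)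
    (by
      rw [min_eq_left hsT, max_eq_right hsT, min_eq_left hε1, max_eq_right hε1]
      exact fun p hp => hfd p ⟨Ioo_subset_Icc_self hp.1.1, Ioo_subset_Icc_self hp.1.2⟩)
    (by
      rw [min_eq_left hsT, max_eq_right hsT, min_eq_left hε1, max_eq_right hε1]
      exact fun p hp => hgd p ⟨Ioo_subset_Icc_self hp.1.1, Ioo_subset_Icc_self hp.1.2⟩)
    (by
      rw [hu1, hu2]
      exact integrableOn_zero.congr_fun (fun p hp => (hdiv p hp).symm)
        (measurableSet_Icc.prod measurableSet_Icc))
  have hzero : ∫ t in s..T, ∫ x in ε..1, fderiv ℝ f (t, x) (1, 0) +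
      fderiv ℝ g (t, x) (0, 1) = 0 := by
    refine (intervalIntegral.integral_congr (g := fun _ => 0) fun t ht => ?_).trans
      intervalIntegral.integral_zero
    exact (intervalIntegral.integral_congr (g := fun _ => 0) fun x hx =>
      hdiv (t, x) ⟨hu1 ▸ ht, hu2 ▸ hx⟩).trans intervalIntegral.integral_zero
  rw [hzero] at hint
  simp only [hfdef, hgdef, mul_one, one_mul, intervalIntegral.integral_neg,
    intervalIntegral.integral_const_mul, intervalIntegral.mul_integral_comp_mul_left] at hint
  linarith

/-- A function bounded below by `c / r²` on `(0, ρ)` has unbounded integrals near `0`. -/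
lemma not_integral_bounded_of_inv_sq_le {h : ℝ → ℝ} {c C ρ : ℝ} (hc : 0 < c) (hρ : 0 < ρ)
    (hint : ∀ r ∈ Ioo 0 ρ, IntervalIntegrable h volume r ρ)
    (hnn : ∀ r ∈ Ioo 0 ρ, 0 ≤ h r)
    (hlow : ∀ r ∈ Ioo 0 ρ, c / r ^ 2 ≤ h r)
    (hC : ∀ r ∈ Ioo 0 ρ, ∫ x in r..ρ, h x ≤ C) : False := by
  set r : ℝ := min (ρ / 4) (c / (8 * (|C| + 1))) with hr
  have hC0 : 0 < |C| + 1 := by positivity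
  have hr0 : 0 < r := lt_min (by positivity) (by positivity)
  have hr1 : r ≤ ρ / 4 := min_le_left _ _
  have hr2 : r ≤ c / (8 * (|C| + 1)) := min_le_right _ _
  rw [le_div_iff₀ (by positivity)] at hr2
  have hi := hint r ⟨hr0, by linarith⟩
  have hi2 := hint (2 * r) ⟨by linarith, by linarith⟩
  have hi1 : IntervalIntegrable h volume r (2 * r) := hi.trans hi2.symm
  have hsplit := intervalIntegral.integral_add_adjacent_intervals hi1 hi2
  have htail : 0 ≤ ∫ x in (2 * r)..ρ, h x := by
    refine intervalIntegral.integral_nonneg_of_ae_restrict (by linarith) ?_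
    rw [← restrict_Ioo_eq_restrict_Icc]
    filter_upwards [ae_restrict_mem measurableSet_Ioo] with x hx
    exact hnn x ⟨by linarith [hx.1], hx.2⟩
  have hhead : ∫ _ in r..(2 * r), c / (2 * r) ^ 2 ≤ ∫ x in r..(2 * r), h x := by
    refine intervalIntegral.integral_mono_on (by linarith) (by simp) hi1 fun x hx => ?_
    have hx0 : 0 < x := by linarith [hx.1]
    refine le_trans ?_ (hlow x ⟨hx0, by linarith [hx.2]⟩)
    have := hx.2
    gcongr
  rw [intervalIntegral.integral_const, smul_eq_mul] at hhead
  have e : (2 * r - r) * (c / (2 * r) ^ 2) = c / (4 * r) := by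
    field_simp
    ring
  have hle : c / (4 * r) ≤ C := by
    have := hC r ⟨hr0, by linarith⟩
    linarith
  rw [div_le_iff₀ (by positivity)] at hle
  nlinarith [le_abs_self C, abs_nonneg C]

/-- The radial energy density `r² e(t,r)`. -/
noncomputable def radialEnergy (u : ℝ → ℝ → ℝ) (t r : ℝ) : ℝ :=
  (1 / 2) * r ^ 2 * (ut u t r ^ 2 + ur u t r ^ 2) + Real.sin (u t r) ^ 2 +
    anP (u t r) ^ 2 / (2 * r ^ 2)

/-- The radial momentum density `r² uₜ uᵣ`. -/
noncomputable def radialMomentum (u : ℝ → ℝ → ℝ) (t r : ℝ) : ℝ :=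
  r ^ 2 * (ut u t r * ur u t r)

/-- The integrand of the flux. -/
noncomputable def fluxDens (u : ℝ → ℝ → ℝ) (r : ℝ) : ℝ :=
  ((1 / 2) * uplus u r r ^ 2 + Real.sin (u r r) ^ 2 / r ^ 2 +
    (u r r - Real.sin (u r r) * Real.cos (u r r)) ^ 2 / (2 * r ^ 4)) * r ^ 2

section

variable {u : ℝ → ℝ → ℝ}

lemma eDens_mul_sq {t r : ℝ} (hr : r ≠ 0) : eDens u t r * r ^ 2 = radialEnergy u t r := by
  unfold eDens radialEnergy anP
  field_simp

lemma radialEnergy_nonneg (t r : ℝ) : 0 ≤ radialEnergy u t r := by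
  unfold radialEnergy
  positivity

lemma radialEnergy_add_radialMomentum {r : ℝ} (hr : r ≠ 0) :
    radialEnergy u r r + radialMomentum u r r = fluxDens u r := by
  unfold radialEnergy radialMomentum fluxDens uplus anP
  field_simp
  ring

lemma fluxDens_nonneg (r : ℝ) : 0 ≤ fluxDens u r := by
  unfold fluxDens
  positivity

lemma anP_mul_uplus_le_fluxDens {r : ℝ} (hr : r ≠ 0) :
    |anP (u r r) * uplus u r r| ≤ fluxDens u r := by
  have e : fluxDens u r = ((uplus u r r * r) ^ 2 + (anP (u r r) / r) ^ 2) / 2 +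
      Real.sin (u r r) ^ 2 := by
    unfold fluxDens anP
    field_simp
    ring
  have e2 : anP (u r r) * uplus u r r = (uplus u r r * r) * (anP (u r r) / r) := by
    field_simp
  rw [e, e2, abs_le]
  constructor <;>
    nlinarith [sq_nonneg (uplus u r r * r + anP (u r r) / r),
      sq_nonneg (uplus u r r * r - anP (u r r) / r), sq_nonneg (Real.sin (u r r))]

lemma inv_sq_le_fluxDens {r : ℝ} (hr : r ≠ 0) :
    anP (u r r) ^ 2 / 2 / r ^ 2 ≤ fluxDens u r := by
  have e : fluxDens u r = anP (u r r) ^ 2 / 2 / r ^ 2 + ((uplus u r r * r) ^ 2 / 2 +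
      Real.sin (u r r) ^ 2) := by
    unfold fluxDens anP
    field_simp
    ring
  rw [e]
  have : 0 ≤ (uplus u r r * r) ^ 2 / 2 + Real.sin (u r r) ^ 2 := by positivity
  linarith

lemma inv_sq_le_radialEnergy {t r : ℝ} :
    anP (u t r) ^ 2 / 2 / r ^ 2 ≤ radialEnergy u t r := by
  unfold radialEnergy
  rw [div_div]
  have : 0 ≤ (1 / 2) * r ^ 2 * (ut u t r ^ 2 + ur u t r ^ 2) + Real.sin (u t r) ^ 2 := by
    positivity
  linarith

variable {V : Set (ℝ × ℝ)}

lemma differentiableAt_radialEnergy (hV : IsOpen V)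
    (hu : ContDiffOn ℝ (⊤ : ℕ∞) (fun p : ℝ × ℝ => u p.1 p.2) V) {t r : ℝ} (hp : (t, r) ∈ V)
    (hr : r ≠ 0) : DifferentiableAt ℝ (fun p : ℝ × ℝ => radialEnergy u p.1 p.2) (t, r) := by
  have h0 := differentiableAt_of_smooth hV hu hp
  have h1 := differentiableAt_of_smooth hV (contDiffOn_ut hV hu) hp
  have h2 := differentiableAt_of_smooth hV (contDiffOn_ur hV hu) hp
  unfold radialEnergy anP
  fun_prop (disch := simpa using hr)

lemma differentiableAt_radialMomentum (hV : IsOpen V)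
    (hu : ContDiffOn ℝ (⊤ : ℕ∞) (fun p : ℝ × ℝ => u p.1 p.2) V) {t r : ℝ} (hp : (t, r) ∈ V) :
    DifferentiableAt ℝ (fun p : ℝ × ℝ => radialMomentum u p.1 p.2) (t, r) := by
  have h1 := differentiableAt_of_smooth hV (contDiffOn_ut hV hu) hp
  have h2 := differentiableAt_of_smooth hV (contDiffOn_ur hV hu) hp
  unfold radialMomentum
  fun_prop

/-- The local conservation law `∂ₜ (r² e) = ∂ᵣ (r² uₜ uᵣ)`. -/
lemma ut_radialEnergy_eq (hV : IsOpen V)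
    (hu : ContDiffOn ℝ (⊤ : ℕ∞) (fun p : ℝ × ℝ => u p.1 p.2) V) {t r : ℝ} (hp : (t, r) ∈ V)
    (hr : r ≠ 0) (heq : ANeq u t r) : ut (radialEnergy u) t r = ur (radialMomentum u) t r := by
  have dt : ∀ {f : ℝ → ℝ → ℝ}, ContDiffOn ℝ (⊤ : ℕ∞) (fun p : ℝ × ℝ => f p.1 p.2) V →
      HasDerivAt (fun s => f s r) (ut f t r) t := fun hf =>
    (hasDerivAt_fst (differentiableAt_of_smooth hV hf hp)).differentiableAt.hasDerivAt
  have dr : ∀ {f : ℝ → ℝ → ℝ}, ContDiffOn ℝ (⊤ : ℕ∞) (fun p : ℝ × ℝ => f p.1 p.2) V →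
      HasDerivAt (fun s => f t s) (ur f t r) r := fun hf =>
    (hasDerivAt_snd (differentiableAt_of_smooth hV hf hp)).differentiableAt.hasDerivAt
  have h1 := contDiffOn_ut hV hu
  have h2 := contDiffOn_ur hV hu
  have hE : HasDerivAt (fun s => radialEnergy u s r) _ t :=
    (((((dt h1).pow 2).add ((dt h2).pow 2)).const_mul ((1 / 2) * r ^ 2)).add
      ((dt hu).sin.pow 2)).add
      ((((hasDerivAt_anP (u t r)).comp t (dt hu)).pow 2).div_const (2 * r ^ 2))
  have hM : HasDerivAt (fun s => radialMomentum u t s) _ r :=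
    ((hasDerivAt_id r).pow 2).mul ((dr h1).mul (dr h2))
  have eE : ut (radialEnergy u) t r = _ := hE.deriv
  have eM : ur (radialMomentum u) t r = _ := hM.deriv
  rw [eE, eM, ut_ur_comm hV hu hp]
  have heq' : ut (ut u) t r = ur (ur u) t r + (2 / r) * ur u t r - Real.sin (2 * u t r) / r ^ 2 -
      anP (u t r) * (1 - Real.cos (2 * u t r)) / r ^ 4 := by
    have h : ut (ut u) t r - ur (ur u) t r - (2 / r) * ur u t r + Real.sin (2 * u t r) / r ^ 2 +
      anP (u t r) * (1 - Real.cos (2 * u t r)) / r ^ 4 = 0 := heq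
    linarith
  rw [heq', Real.sin_two_mul]
  simp
  field_simp
  ring

lemma hasDerivAt_diagonal {r : ℝ}
    (hd : DifferentiableAt ℝ (fun p : ℝ × ℝ => u p.1 p.2) (r, r)) :
    HasDerivAt (fun s => u s s) (uplus u r r) r := by
  have h := HasFDerivAt.comp_hasDerivAt (f := fun s : ℝ => (s, s)) r hd.hasFDerivAt
    ((hasDerivAt_id r).prodMk (hasDerivAt_id r))
  refine h.congr_deriv ?_
  have e : ((1 : ℝ), (1 : ℝ)) = (1, 0) + (0, 1) := by simp
  rw [e, map_add, ← ut_eq_fderiv hd, ← ur_eq_fderiv hd, uplus]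

variable {T : ℝ}

lemma mem_Dom {t r : ℝ} (ht : t ∈ Ioc 0 T) (hr : r ∈ Icc 0 t) : (t, r) ∈ Dom T :=
  ⟨ht.1, by dsimp only; linarith [ht.1, ht.2], hr.1,
    le_min (by dsimp only; linarith [hr.2, ht.2]) hr.2⟩

lemma sin_center_eq_zero (hV : IsOpen V) (hDV : Dom T ⊆ V)
    (hu : ContDiffOn ℝ (⊤ : ℕ∞) (fun p : ℝ × ℝ => u p.1 p.2) V)
    (heq : ∀ p ∈ Dom T, 0 < p.2 → ANeq u p.1 p.2) {t : ℝ} (ht : t ∈ Ioc 0 T) :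
    Real.sin (u t 0) = 0 := by
  have hp : (t, (0 : ℝ)) ∈ V := hDV (mem_Dom ht ⟨le_rfl, ht.1.le⟩)
  have cont : ∀ {f : ℝ → ℝ → ℝ}, ContDiffOn ℝ (⊤ : ℕ∞) (fun p : ℝ × ℝ => f p.1 p.2) V →
      ContinuousAt (fun s => f t s) 0 := fun hf =>
    (hasDerivAt_snd (differentiableAt_of_smooth hV hf hp)).continuousAt
  have c0 := cont hu
  have c1 := cont (contDiffOn_ur hV hu)
  have c2 := cont (contDiffOn_ut hV (contDiffOn_ut hV hu))
  have c3 := cont (contDiffOn_ur hV (contDiffOn_ur hV hu))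
  set k : ℝ → ℝ := fun r => r ^ 4 * (ut (ut u) t r - ur (ur u) t r) - 2 * r ^ 3 * ur u t r +
    r ^ 2 * Real.sin (2 * u t r) +
    (u t r - Real.sin (u t r) * Real.cos (u t r)) * (1 - Real.cos (2 * u t r)) with hk
  have hkc : ContinuousAt k 0 := by
    have hs : ContinuousAt (fun r => Real.sin (u t r)) 0 := Real.continuous_sin.continuousAt.comp c0
    have hc : ContinuousAt (fun r => Real.cos (u t r)) 0 := Real.continuous_cos.continuousAt.comp c0
    have hs2 : ContinuousAt (fun r => Real.sin (2 * u t r)) 0 :=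
      Real.continuous_sin.continuousAt.comp (continuousAt_const.mul c0)
    have hc2 : ContinuousAt (fun r => Real.cos (2 * u t r)) 0 :=
      Real.continuous_cos.continuousAt.comp (continuousAt_const.mul c0)
    fun_prop
  have hk0 : k =ᶠ[𝓝[>] 0] fun _ => 0 := by
    filter_upwards [Ioc_mem_nhdsGT ht.1] with r hr
    have h := heq (t, r) (mem_Dom ht ⟨hr.1.le, hr.2⟩) hr.1
    have hr0 := hr.1.ne'
    have e : k r = r ^ 4 * (utt u t r - urr u t r - (2 / r) * ur u t r +
        Real.sin (2 * u t r) / r ^ 2 +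
        (u t r - Real.sin (u t r) * Real.cos (u t r)) * (1 - Real.cos (2 * u t r)) / r ^ 4) := by
      change _ = r ^ 4 * (ut (ut u) t r - ur (ur u) t r - _ + _ + _)
      simp only [hk]
      field_simp
    rw [e, show _ = (0 : ℝ) from h, mul_zero]
  have hk00 : k 0 = 0 := tendsto_nhds_unique (hkc.tendsto.mono_left nhdsWithin_le_nhds)
    (tendsto_const_nhds.congr' hk0.symm)
  have h0 : (u t 0 - Real.sin (u t 0) * Real.cos (u t 0)) * (1 - Real.cos (2 * u t 0)) = 0 := by
    simpa [hk] using hk00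
  rcases mul_eq_zero.mp h0 with h | h
  · have hz : u t 0 = 0 := by
      by_contra hne
      have h2 := anP_sq_le (abs_nonneg (u t 0)) le_rfl
      have h3 := anP_pos (abs_pos.mpr hne)
      have h4 : anP (u t 0) = 0 := h
      rw [h4] at h2
      nlinarith
    rw [hz, Real.sin_zero]
  · rw [Real.cos_two_mul] at h
    have := Real.sin_sq_add_cos_sq (u t 0)
    exact pow_eq_zero_iff (two_ne_zero) |>.mp (by linarith)

lemma intervalIntegrable_radialEnergy (hT : 0 < T)
    (hint : IntegrableOn (fun r => eDens u T r * r ^ 2) (Ioc 0 T)) :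
    IntervalIntegrable (radialEnergy u T) volume 0 T := by
  rw [intervalIntegrable_iff_integrableOn_Ioc_of_le hT.le]
  exact hint.congr_fun (fun r hr => eDens_mul_sq hr.1.ne') measurableSet_Ioc

lemma center_eq_zero_of_integrableOn (hV : IsOpen V) (hDV : Dom T ⊆ V)
    (hu : ContDiffOn ℝ (⊤ : ℕ∞) (fun p : ℝ × ℝ => u p.1 p.2) V) (hT : 0 < T)
    (hint : IntegrableOn (fun r => eDens u T r * r ^ 2) (Ioc 0 T)) : u T 0 = 0 := by
  by_contra hne
  have hp : (T, (0 : ℝ)) ∈ V := hDV (mem_Dom ⟨hT, le_rfl⟩ ⟨le_rfl, hT.le⟩)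
  have hc := (hasDerivAt_snd (differentiableAt_of_smooth hV hu hp)).continuousAt.abs
  have ha : |u T 0| / 2 < |u T 0| := half_lt_self (abs_pos.mpr hne)
  obtain ⟨δ, hδ, hδ'⟩ := Metric.eventually_nhds_iff.mp (hc.tendsto.eventually (lt_mem_nhds ha))
  have hi := intervalIntegrable_radialEnergy hT hint
  have hρ : 0 < min δ T := lt_min hδ hT
  have hsub : ∀ r ∈ Ioo 0 (min δ T), uIcc r (min δ T) ⊆ uIcc 0 T := fun r hr => by
    rw [uIcc_of_le hr.2.le, uIcc_of_le hT.le]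
    exact Icc_subset_Icc hr.1.le (min_le_right _ _)
  refine not_integral_bounded_of_inv_sq_le (h := radialEnergy u T) (ρ := min δ T)
    (c := anP (|u T 0| / 2) ^ 2 / 2) (C := ∫ r in (0 : ℝ)..T, radialEnergy u T r) ?_ hρ
    (fun r hr => hi.mono_set (hsub r hr)) (fun r _ => radialEnergy_nonneg T r) ?_ ?_
  · have := anP_pos (half_pos (abs_pos.mpr hne))
    positivity
  · intro r hr
    refine le_trans ?_ inv_sq_le_radialEnergy
    have hr' : dist r 0 < δ := by
      rw [Real.dist_eq, sub_zero, abs_of_pos hr.1]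
      exact hr.2.trans_le (min_le_left _ _)
    have := anP_sq_le (by positivity) (hδ' hr').le
    gcongr
  · intro r hr
    exact intervalIntegral.integral_mono_interval hr.1.le hr.2.le (min_le_right _ _)
      (ae_of_all _ fun r => radialEnergy_nonneg T r) hi

lemma center_eq_zero (hV : IsOpen V) (hDV : Dom T ⊆ V)
    (hu : ContDiffOn ℝ (⊤ : ℕ∞) (fun p : ℝ × ℝ => u p.1 p.2) V)
    (heq : ∀ p ∈ Dom T, 0 < p.2 → ANeq u p.1 p.2)
    (hint : IntegrableOn (fun r => eDens u T r * r ^ 2) (Ioc 0 T)) {t : ℝ} (ht : t ∈ Ioc 0 T) :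
    u t 0 = 0 := by
  have hT : 0 < T := ht.1.trans_le ht.2
  by_contra hne
  have hmem : ∀ t' ∈ Icc t T, t' ∈ Ioc 0 T := fun t' h => ⟨ht.1.trans_le h.1, h.2⟩
  have hcont : ContinuousOn (fun s => |u s 0|) (Icc t T) := fun s hs =>
    (hasDerivAt_fst (differentiableAt_of_smooth hV hu
      (hDV (mem_Dom (hmem s hs) ⟨le_rfl, (hmem s hs).1.le⟩)))).continuousAt.abs.continuousWithinAt
  have hpos := abs_pos.mpr hne
  set c := min |u t 0| Real.pi / 2 with hcdef
  have hm : 0 < min |u t 0| Real.pi := lt_min hpos Real.pi_pos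
  have hc0 : 0 < c := half_pos hm
  have hc1 : c ≤ |u t 0| := (half_le_self hm.le).trans (min_le_left _ _)
  have hc2 : c < Real.pi := (half_lt_self hm).trans_le (min_le_right _ _)
  have hT0 := center_eq_zero_of_integrableOn hV hDV hu hT hint
  obtain ⟨s, hs, hsc⟩ := intermediate_value_Icc' ht.2 hcont
    (show c ∈ Icc |u T 0| |u t 0| from ⟨by rw [hT0, abs_zero]; exact hc0.le, hc1⟩)
  have h1 := sin_center_eq_zero hV hDV hu heq (hmem s hs)
  have h2 := Real.sin_pos_of_pos_of_lt_pi hc0 hc2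
  have h3 : |u s 0| = c := hsc
  rw [← h3] at h2
  rcases abs_choice (u s 0) with h | h <;> rw [h] at h2
  · linarith
  · rw [Real.sin_neg] at h2
    linarith

/-- The densities near the centre are uniformly small on compact time intervals. -/
lemma exists_center_bound (hV : IsOpen V) (hDV : Dom T ⊆ V)
    (hu : ContDiffOn ℝ (⊤ : ℕ∞) (fun p : ℝ × ℝ => u p.1 p.2) V)
    (hcen : ∀ t ∈ Ioc 0 T, u t 0 = 0) {s : ℝ} (hs : 0 < s) :
    ∃ K : ℝ, ∀ ε ∈ Ioc (0 : ℝ) 1, ∀ t ∈ Icc s T,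
      |ε * radialEnergy u t (t * ε) + radialMomentum u t (t * ε)| ≤ K * ε := by
  set S : Set (ℝ × ℝ) := (Icc s T ×ˢ Icc 0 T) ∩ {p | p.2 ≤ p.1} with hS
  have hScomp : IsCompact S :=
    (isCompact_Icc.prod isCompact_Icc).inter_right (isClosed_le continuous_snd continuous_fst)
  have hSV : S ⊆ V := fun p hp =>
    hDV (mem_Dom ⟨hs.trans_le hp.1.1.1, hp.1.1.2⟩ ⟨hp.1.2.1, hp.2⟩)
  obtain ⟨M₁, hM₁⟩ := hScomp.exists_bound_of_continuousOn
    ((contDiffOn_ut hV hu).continuousOn.mono hSV)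
  obtain ⟨M₂, hM₂⟩ := hScomp.exists_bound_of_continuousOn
    ((contDiffOn_ur hV hu).continuousOn.mono hSV)
  set M := max M₁ M₂ with hM
  refine ⟨2 * M ^ 2 * (T ^ 2 + 1) + T ^ 2 * M ^ 2, fun ε hε t ht => ?_⟩
  have ht0 : 0 < t := hs.trans_le ht.1
  set r := t * ε with hr
  have hr0 : 0 < r := mul_pos ht0 hε.1
  have hrt : r ≤ t := mul_le_of_le_one_right ht0.le hε.2
  have hmem : ∀ x ∈ Icc 0 r, (t, x) ∈ S := fun x hx =>
    ⟨⟨ht, hx.1, by linarith [hx.2, ht.2]⟩, hx.2.trans hrt⟩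
  have ha : |ut u t r| ≤ M := (hM₁ _ (hmem r ⟨hr0.le, le_rfl⟩)).trans (le_max_left _ _)
  have hb : ∀ x ∈ Icc 0 r, |ur u t x| ≤ M := fun x hx =>
    (hM₂ _ (hmem x hx)).trans (le_max_right _ _)
  have hM0 : 0 ≤ M := (abs_nonneg _).trans ha
  have hur : |u t r| ≤ M * r := by
    have h := norm_image_sub_le_of_norm_deriv_le_segment' (f := fun x => u t x)
      (f' := fun x => ur u t x) (a := 0) (b := r) (C := M)
      (fun x hx => by
        have hd := differentiableAt_of_smooth hV hu (hSV (hmem x hx))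
        rw [ur_eq_fderiv hd]
        exact (hasDerivAt_snd hd).hasDerivWithinAt)
      (fun x hx => hb x ⟨hx.1, hx.2.le⟩) r ⟨hr0.le, le_rfl⟩
    simpa [hcen t ⟨ht0, ht.2⟩] using h
  have hb' := hb r ⟨hr0.le, le_rfl⟩
  have ha2 : ut u t r ^ 2 ≤ M ^ 2 := sq_le_sq.mpr (ha.trans (le_abs_self _))
  have hb2 : ur u t r ^ 2 ≤ M ^ 2 := sq_le_sq.mpr (hb'.trans (le_abs_self _))
  have hu2 : u t r ^ 2 ≤ (M * r) ^ 2 := sq_le_sq.mpr (hur.trans (le_abs_self _))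
  have hsin : Real.sin (u t r) ^ 2 ≤ (M * r) ^ 2 :=
    (sq_le_sq.mpr Real.abs_sin_le_abs).trans hu2
  have hP : anP (u t r) ^ 2 / (2 * r ^ 2) ≤ 2 * M ^ 2 := by
    rw [div_le_iff₀ (by positivity)]
    nlinarith [anP_sq_le_sq (u t r)]
  have hr2 : r ^ 2 ≤ T ^ 2 := pow_le_pow_left₀ hr0.le (hrt.trans ht.2) 2
  have hq : radialEnergy u t r ≤ 2 * M ^ 2 * (T ^ 2 + 1) := by
    have h1 : (1 / 2) * r ^ 2 * (ut u t r ^ 2 + ur u t r ^ 2) ≤ (1 / 2) * r ^ 2 * (M ^ 2 + M ^ 2) := by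
      gcongr
    have h2 : M ^ 2 * r ^ 2 ≤ M ^ 2 * T ^ 2 := by gcongr
    unfold radialEnergy
    nlinarith
  have hm : |radialMomentum u t r| ≤ T ^ 2 * M ^ 2 * ε := by
    unfold radialMomentum
    rw [abs_mul, abs_mul, abs_of_nonneg (sq_nonneg r)]
    have h1 : |ut u t r| * |ur u t r| ≤ M * M := by gcongr
    have h2 : r ^ 2 ≤ T ^ 2 * ε := by
      have : r ^ 2 = t ^ 2 * (ε * ε) := by rw [hr]; ring
      rw [this]
      have h3 : t ^ 2 ≤ T ^ 2 := pow_le_pow_left₀ ht0.le ht.2 2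
      have h4 : ε * ε ≤ ε := mul_le_of_le_one_right hε.1.le hε.2
      have := hε.1.le
      gcongr
    calc r ^ 2 * (|ut u t r| * |ur u t r|) ≤ (T ^ 2 * ε) * (M * M) := by
          have := hε.1.le
          gcongr
      _ = T ^ 2 * M ^ 2 * ε := by ring
  calc |ε * radialEnergy u t r + radialMomentum u t r|
      ≤ |ε * radialEnergy u t r| + |radialMomentum u t r| := abs_add_le _ _
    _ ≤ ε * (2 * M ^ 2 * (T ^ 2 + 1)) + T ^ 2 * M ^ 2 * ε := by
        rw [abs_of_nonneg (mul_nonneg hε.1.le (radialEnergy_nonneg _ _))]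
        have := hε.1.le
        gcongr
    _ = _ := by ring

/-- The flux is bounded by the energy on the final time slice. -/
lemma integral_fluxDens_le (hV : IsOpen V) (hDV : Dom T ⊆ V)
    (hu : ContDiffOn ℝ (⊤ : ℕ∞) (fun p : ℝ × ℝ => u p.1 p.2) V)
    (heq : ∀ p ∈ Dom T, 0 < p.2 → ANeq u p.1 p.2)
    (hint : IntegrableOn (fun r => eDens u T r * r ^ 2) (Ioc 0 T)) {s : ℝ} (hs : s ∈ Ioc 0 T) :
    ∫ r in s..T, fluxDens u r ≤ ∫ r in (0 : ℝ)..T, radialEnergy u T r := by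
  have hT : 0 < T := hs.1.trans_le hs.2
  obtain ⟨K, hK⟩ := exists_center_bound hV hDV hu
    (fun t ht => center_eq_zero hV hDV hu heq hint ht) hs.1
  have hD : ∀ t ∈ Icc s T, ∀ r ∈ Ioc 0 t, (t, r) ∈ Dom T := fun t ht r hr =>
    mem_Dom ⟨hs.1.trans_le ht.1, ht.2⟩ ⟨hr.1.le, hr.2⟩
  have key : ∀ ε ∈ Ioc (0 : ℝ) 1,
      ∫ r in s..T, fluxDens u r ≤ (∫ r in (0 : ℝ)..T, radialEnergy u T r) + K * ε * |T - s| := by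
    intro ε hε
    have h := integral_conservation_law hs.1 hs.2 hε.1 hε.2
      (fun t ht r hr => differentiableAt_radialEnergy hV hu (hDV (hD t ht r hr)) hr.1.ne')
      (fun t ht r hr => differentiableAt_radialMomentum hV hu (hDV (hD t ht r hr)))
      (fun t ht r hr => ut_radialEnergy_eq hV hu (hDV (hD t ht r hr)) hr.1.ne'
        (heq _ (hD t ht r hr) hr.1))
    have e : ∫ t in s..T, (radialEnergy u t t + radialMomentum u t t) =
        ∫ r in s..T, fluxDens u r := intervalIntegral.integral_congr fun r hr => by
      rw [uIcc_of_le hs.2] at hr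
      exact radialEnergy_add_radialMomentum (hs.1.trans_le hr.1).ne'
    have h1 : ∫ r in (T * ε)..T, radialEnergy u T r ≤ ∫ r in (0 : ℝ)..T, radialEnergy u T r :=
      intervalIntegral.integral_mono_interval (mul_nonneg hT.le hε.1.le)
        (mul_le_of_le_one_right hT.le hε.2) le_rfl
        (ae_of_all _ fun r => radialEnergy_nonneg T r) (intervalIntegrable_radialEnergy hT hint)
    have h2 : 0 ≤ ∫ r in (s * ε)..s, radialEnergy u s r :=
      intervalIntegral.integral_nonneg (mul_le_of_le_one_right hs.1.le hε.2)
        fun r _ => radialEnergy_nonneg s r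
    have h3 := intervalIntegral.norm_integral_le_of_norm_le_const (a := s) (b := T)
      (f := fun t => ε * radialEnergy u t (t * ε) + radialMomentum u t (t * ε)) (C := K * ε)
      fun t ht => by
        rw [uIoc_of_le hs.2] at ht
        exact hK ε hε t (Ioc_subset_Icc_self ht)
    have h4 := (Real.le_norm_self _).trans h3
    linarith
  have hlim : Tendsto (fun ε : ℝ => (∫ r in (0 : ℝ)..T, radialEnergy u T r) + K * ε * |T - s|)
      (𝓝[>] 0) (𝓝 ((∫ r in (0 : ℝ)..T, radialEnergy u T r) + K * 0 * |T - s|)) :=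
    (Continuous.tendsto (by fun_prop) _).mono_left nhdsWithin_le_nhds
  rw [mul_zero, zero_mul, add_zero] at hlim
  refine ge_of_tendsto hlim ?_
  filter_upwards [Ioc_mem_nhdsGT one_pos] with ε hε using key ε hε

lemma continuousOn_fluxDens (hV : IsOpen V) (hDV : Dom T ⊆ V)
    (hu : ContDiffOn ℝ (⊤ : ℕ∞) (fun p : ℝ × ℝ => u p.1 p.2) V) :
    ContinuousOn (fluxDens u) (Ioc 0 T) := by
  have h : ContinuousOn (fun r => radialEnergy u r r + radialMomentum u r r) (Ioc 0 T) := by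
    intro r hr
    have hp : (r, r) ∈ V := hDV (mem_Dom hr ⟨hr.1.le, le_rfl⟩)
    have hd : ContinuousAt (fun r : ℝ => (r, r)) r := by fun_prop
    exact ((ContinuousAt.comp (f := fun r : ℝ => (r, r))
      (g := fun p : ℝ × ℝ => radialEnergy u p.1 p.2)
      (differentiableAt_radialEnergy hV hu hp hr.1.ne').continuousAt hd).add
      (ContinuousAt.comp (f := fun r : ℝ => (r, r))
      (g := fun p : ℝ × ℝ => radialMomentum u p.1 p.2)
      (differentiableAt_radialMomentum hV hu hp).continuousAt hd)).continuousWithinAt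
  exact h.congr fun r hr => (radialEnergy_add_radialMomentum hr.1.ne').symm

lemma intervalIntegrable_fluxDens (hV : IsOpen V) (hDV : Dom T ⊆ V)
    (hu : ContDiffOn ℝ (⊤ : ℕ∞) (fun p : ℝ × ℝ => u p.1 p.2) V)
    (heq : ∀ p ∈ Dom T, 0 < p.2 → ANeq u p.1 p.2) (hT : 0 < T)
    (hint : IntegrableOn (fun r => eDens u T r * r ^ 2) (Ioc 0 T)) :
    IntervalIntegrable (fluxDens u) volume 0 T := by
  rw [intervalIntegrable_iff_integrableOn_Ioc_of_le hT.le]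
  have ha : ∀ i : ℕ, T * (1 / ((i : ℝ) + 1)) ∈ Ioc 0 T := fun i => by
    have : 1 / ((i : ℝ) + 1) ≤ 1 := by
      rw [div_le_one (by positivity)]
      linarith [(Nat.cast_nonneg i : (0 : ℝ) ≤ i)]
    exact ⟨by positivity, mul_le_of_le_one_right hT.le this⟩
  have hlim := tendsto_one_div_add_atTop_nhds_zero_nat (𝕜 := ℝ) |>.const_mul T
  rw [mul_zero] at hlim
  refine integrableOn_Ioc_of_intervalIntegral_norm_bounded_left
    (I := ∫ r in (0 : ℝ)..T, radialEnergy u T r) (fun i => ?_) hlim (Eventually.of_forall fun i => ?_)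
  · exact (((continuousOn_fluxDens hV hDV hu).mono fun x hx =>
      ⟨(ha i).1.trans_le hx.1, hx.2⟩).integrableOn_Icc).mono_set Ioc_subset_Icc_self
  · simp_rw [Real.norm_of_nonneg (fluxDens_nonneg (u := u) _)]
    rw [← intervalIntegral.integral_of_le (ha i).2]
    exact integral_fluxDens_le hV hDV hu heq hint (ha i)

lemma anG_diagonal_le (hV : IsOpen V) (hDV : Dom T ⊆ V)
    (hu : ContDiffOn ℝ (⊤ : ℕ∞) (fun p : ℝ × ℝ => u p.1 p.2) V)
    (hi : IntervalIntegrable (fluxDens u) volume 0 T) {s t : ℝ} (hs : 0 < s) (hst : s ≤ t)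
    (ht : t ≤ T) :
    anG (u t t) ≤ anG (u s s) + ∫ r in (0 : ℝ)..t, fluxDens u r := by
  have hmem : ∀ r ∈ Icc s t, (r, r) ∈ V := fun r hr =>
    hDV (mem_Dom ⟨hs.trans_le hr.1, hr.2.trans ht⟩ ⟨hs.le.trans hr.1, le_rfl⟩)
  have hd : ∀ r ∈ Icc s t, HasDerivAt (fun r => u r r) (uplus u r r) r := fun r hr =>
    hasDerivAt_diagonal (differentiableAt_of_smooth hV hu (hmem r hr))
  have hdiag : ContinuousOn (fun r : ℝ => (r, r)) (Icc s t) := by fun_prop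
  have hplus : ContinuousOn (fun r => uplus u r r) (Icc s t) :=
    ((contDiffOn_ut hV hu).continuousOn.comp hdiag hmem).add
      ((contDiffOn_ur hV hu).continuousOn.comp hdiag hmem)
  have hPc : ContinuousOn (fun r => anP (u r r)) (Icc s t) := fun r hr =>
    (HasDerivAt.comp (h := fun r => u r r) r (hasDerivAt_anP (u r r)) (hd r hr)).continuousAt.continuousWithinAt
  have hdi : IntervalIntegrable (fun r => anP (u r r) * uplus u r r) volume s t :=
    ContinuousOn.intervalIntegrable (by rw [uIcc_of_le hst]; exact hPc.mul hplus)
  have hftc := intervalIntegral.integral_eq_sub_of_hasDerivAt (f := fun r => anG (u r r))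
    (f' := fun r => anP (u r r) * uplus u r r) (a := s) (b := t)
    (fun r hr => by
      rw [uIcc_of_le hst] at hr
      exact HasDerivAt.comp (h := fun r => u r r) r (hasDerivAt_anG (u r r)) (hd r hr)) hdi
  have hi0 : IntervalIntegrable (fluxDens u) volume 0 t := hi.mono_set (by
    rw [uIcc_of_le (hs.le.trans hst), uIcc_of_le (hs.le.trans (hst.trans ht))]
    exact Icc_subset_Icc le_rfl ht)
  have his : IntervalIntegrable (fluxDens u) volume s t := hi0.mono_set (by
    rw [uIcc_of_le (hs.le.trans hst), uIcc_of_le hst]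
    exact Icc_subset_Icc hs.le le_rfl)
  have h1 : ∫ r in s..t, anP (u r r) * uplus u r r ≤ ∫ r in s..t, fluxDens u r :=
    intervalIntegral.integral_mono_on hst hdi his fun r hr =>
      (le_abs_self _).trans (anP_mul_uplus_le_fluxDens (hs.trans_le hr.1).ne')
  have h2 : ∫ r in s..t, fluxDens u r ≤ ∫ r in (0 : ℝ)..t, fluxDens u r :=
    intervalIntegral.integral_mono_interval hs.le hst le_rfl
      (ae_of_all _ fun r => fluxDens_nonneg r) hi0
  linarith

/-- Finite flux forces `u` to take arbitrarily small values along the light cone. -/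
lemma exists_anG_diagonal_lt (hi : IntervalIntegrable (fluxDens u) volume 0 T) {t η : ℝ}
    (ht : t ∈ Ioc 0 T) (hη : 0 < η) : ∃ s ∈ Ioo 0 t, anG (u s s) < η := by
  by_contra! hcon
  have hT := ht.1.trans_le ht.2
  have hsub : ∀ r ∈ Ioo 0 t, uIcc r t ⊆ uIcc 0 T := fun r hr => by
    rw [uIcc_of_le hr.2.le, uIcc_of_le hT.le]
    exact Icc_subset_Icc hr.1.le ht.2
  have hc : 0 < Real.sqrt (2 * η) := Real.sqrt_pos.mpr (by positivity)
  refine not_integral_bounded_of_inv_sq_le (h := fluxDens u) (ρ := t)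
    (c := anP (Real.sqrt (2 * η)) ^ 2 / 2) (C := ∫ r in (0 : ℝ)..T, fluxDens u r) ?_ ht.1
    (fun r hr => hi.mono_set (hsub r hr)) (fun r _ => fluxDens_nonneg r) ?_ ?_
  · have := anP_pos hc
    positivity
  · intro r hr
    refine le_trans ?_ (inv_sq_le_fluxDens hr.1.ne')
    have h1 : Real.sqrt (2 * η) ≤ |u r r| := by
      rw [← Real.sqrt_sq_eq_abs]
      exact Real.sqrt_le_sqrt (by linarith [hcon r hr, anG_le_sq (u r r)])
    have := anP_sq_le hc.le h1
    gcongr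
  · intro r hr
    exact intervalIntegral.integral_mono_interval hr.1.le hr.2.le ht.2
      (ae_of_all _ fun r => fluxDens_nonneg r) hi

end

/-- In the backward framework, the flux `F(0,T)` (defined as the limit of `F(s,T)` as
`s → 0⁺`) vanishes as `T → 0⁺`, and the solution tends to `0` along the forward light
cone: `u(T,T) → 0` as `T → 0⁺`. -/
theorem flux_decay_and_lightcone_limit (u : ℝ → ℝ → ℝ) (Tbar : ℝ)
    (h : BackwardFramework u Tbar) :
    ∃ F0 : ℝ → ℝ,
      (∀ T : ℝ, 0 < T → T ≤ Tbar →
        Tendsto (fun s => flux u s T) (𝓝[>] (0 : ℝ)) (𝓝 (F0 T))) ∧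
      Tendsto F0 (𝓝[>] (0 : ℝ)) (𝓝 0) ∧
      Tendsto (fun T : ℝ => u T T) (𝓝[>] (0 : ℝ)) (𝓝 0) := by
  obtain ⟨hT, ⟨V, hV, hDV, hu⟩, heq, hint⟩ := h
  have hi := intervalIntegrable_fluxDens hV hDV hu heq hT hint
  have hi' : ∀ T ∈ Ioc 0 Tbar, IntegrableOn (fluxDens u) (uIcc 0 T) := fun T ht => by
    rw [uIcc_of_le ht.1.le, integrableOn_Icc_iff_integrableOn_Ioc,
      ← intervalIntegrable_iff_integrableOn_Ioc_of_le ht.1.le]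
    refine hi.mono_set ?_
    rw [uIcc_of_le ht.1.le, uIcc_of_le hT.le]
    exact Icc_subset_Icc le_rfl ht.2
  have hnhds : ∀ T : ℝ, 0 < T → 𝓝[>] (0 : ℝ) ≤ 𝓝[uIcc 0 T] 0 := fun T h0 => by
    rw [uIcc_of_le h0.le]
    exact nhdsWithin_le_of_mem (mem_of_superset (Ioc_mem_nhdsGT h0) Ioc_subset_Icc_self)
  have hflux : Tendsto (fun T => flux u 0 T) (𝓝[>] 0) (𝓝 0) := by
    have h1 := (intervalIntegral.continuousOn_primitive_interval
      (hi' Tbar ⟨hT, le_rfl⟩) 0 left_mem_uIcc).tendsto.mono_left (hnhds Tbar hT)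
    rwa [intervalIntegral.integral_same] at h1
  refine ⟨fun T => flux u 0 T, fun T h0 h1 => ?_, hflux, ?_⟩
  · exact (intervalIntegral.continuousOn_primitive_interval_left
      (hi' T ⟨h0, h1⟩) 0 left_mem_uIcc).tendsto.mono_left (hnhds T h0)
  · have hG : ∀ T ∈ Ioc 0 Tbar, anG (u T T) ≤ flux u 0 T := fun T ht => by
      refine le_of_forall_pos_le_add fun η hη => ?_
      obtain ⟨s, hs, hsη⟩ := exists_anG_diagonal_lt hi ht hη
      have h1 := anG_diagonal_le hV hDV hu hi hs.1 hs.2.le ht.2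
      change _ ≤ (∫ r in (0 : ℝ)..T, fluxDens u r) + η
      linarith
    rw [Metric.tendsto_nhds]
    intro ε hε
    filter_upwards [hflux.eventually (gt_mem_nhds (anG_pos hε)), Ioc_mem_nhdsGT hT] with T h1 h2
    rw [Real.dist_eq, sub_zero]
    by_contra! h3
    exact absurd (anG_le hε.le h3) (not_le.mpr ((hG T h2).trans_lt h1))
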